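/- Let T be a leafless ℝ-tree and let H be a group of isometries of T every element of which is elliptic. Then either every H-orbit in T has bounded diameter, or there is exactly one end of T that is fixed by every element of H (and in that case the H-orbits are unbounded). -/

import Mathlib

/-- `s` is a geodesic segment joining `x` to `y`: the image of an isometric embedding of a
compact real interval, with endpoints `x` and `y`. -/
def IsGeodesicSegmentBetween {X : Type*} [MetricSpace X] (s : Set X) (x y : X) : Prop :=
  ∃ (γ : ℝ → X) (b : ℝ), 0 ≤ b ∧
    (∀ u ∈ Set.Icc (0 : ℝ) b, ∀ v ∈ Set.Icc (0 : ℝ) b, dist (γ u) (γ v) = |u - v|) ∧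
    γ 0 = x ∧ γ b = y ∧ s = γ '' Set.Icc 0 b

/-- `s` is a geodesic segment. -/
def IsGeodesicSegment {X : Type*} [MetricSpace X] (s : Set X) : Prop :=
  ∃ x y : X, IsGeodesicSegmentBetween s x y

/-- An ℝ-tree: any two points are joined by a unique geodesic segment, and if two geodesic
segments meet exactly in a common endpoint then their union is a geodesic segment. -/
def IsRTree (X : Type*) [MetricSpace X] : Prop :=
  (∀ x y : X, ∃! s : Set X, IsGeodesicSegmentBetween s x y) ∧
  (∀ (s t : Set X) (x y z : X), IsGeodesicSegmentBetween s x y →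
    IsGeodesicSegmentBetween t y z → s ∩ t = {y} → IsGeodesicSegmentBetween (s ∪ t) x z)

/-- `X` is leafless: every geodesic segment is contained in a strictly larger geodesic segment
extending it beyond each endpoint. -/
def Leafless (X : Type*) [MetricSpace X] : Prop :=
  ∀ (x y : X) (s : Set X), IsGeodesicSegmentBetween s x y →
    ∃ (x' y' : X) (s' : Set X), IsGeodesicSegmentBetween s' x' y' ∧ s ⊆ s' ∧
      0 < dist x' x ∧ 0 < dist y y' ∧ dist x' y' = dist x' x + dist x y + dist y y'

/-- A ray: the image of an isometric embedding of `[0, ∞)`. -/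
def IsRay {X : Type*} [MetricSpace X] (R : Set X) : Prop :=
  ∃ γ : ℝ → X, (∀ u ∈ Set.Ici (0 : ℝ), ∀ v ∈ Set.Ici (0 : ℝ), dist (γ u) (γ v) = |u - v|) ∧
    R = γ '' Set.Ici 0

/-- A ray starting at the point `x`. -/
def IsRayFrom {X : Type*} [MetricSpace X] (x : X) (R : Set X) : Prop :=
  ∃ γ : ℝ → X, (∀ u ∈ Set.Ici (0 : ℝ), ∀ v ∈ Set.Ici (0 : ℝ), dist (γ u) (γ v) = |u - v|) ∧
    γ 0 = x ∧ R = γ '' Set.Ici 0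

/-- An end of `X`, regarded as the set of all rays equivalent to a given ray (two rays are
equivalent when their intersection is a ray). -/
def IsEnd {X : Type*} [MetricSpace X] (e : Set (Set X)) : Prop :=
  ∃ R : Set X, IsRay R ∧ e = {R' : Set X | IsRay R' ∧ IsRay (R' ∩ R)}

/-- The action of a map on ends (as sets of rays), by pushing every ray forward. -/
def pushEnd {X Y : Type*} (φ : X → Y) (e : Set (Set X)) : Set (Set Y) :=
  (Set.image φ) '' e

/-- Two rays starting at `x` locally coincide: their intersection contains more than `x`. -/
def LocCoincide {X : Type*} [MetricSpace X] (x : X) (R R' : Set X) : Prop :=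
  ∃ p, p ∈ R ∩ R' ∧ p ≠ x

/-- `x` is a branch point: the valency of `x` (number of directions at `x`, i.e. classes of
rays from `x` up to local coincidence) is at least `3`. -/
def IsBranchPoint {X : Type*} [MetricSpace X] (x : X) : Prop :=
  ∃ R₁ R₂ R₃ : Set X, IsRayFrom x R₁ ∧ IsRayFrom x R₂ ∧ IsRayFrom x R₃ ∧
    ¬ LocCoincide x R₁ R₂ ∧ ¬ LocCoincide x R₁ R₃ ∧ ¬ LocCoincide x R₂ R₃

/-- `X` is locally finite: every point has finite valency, i.e. finitely many directions. -/
def LocallyFiniteTree (X : Type*) [MetricSpace X] : Prop :=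
  ∀ x : X, ∃ (n : ℕ) (Rs : Fin n → Set X), (∀ i, IsRayFrom x (Rs i)) ∧
    ∀ R : Set X, IsRayFrom x R → ∃ i, LocCoincide x R (Rs i)

/-- `X` admits at least three ends. -/
def AtLeastThreeEnds (X : Type*) [MetricSpace X] : Prop :=
  ∃ e₁ e₂ e₃ : Set (Set X), IsEnd e₁ ∧ IsEnd e₂ ∧ IsEnd e₃ ∧ e₁ ≠ e₂ ∧ e₁ ≠ e₃ ∧ e₂ ≠ e₃

/-- `fbar : X → Y` induces the map `f` on ends: every ray lying in an end `e` is sent to a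
ray lying in the end `f e`. -/
def Induces {X Y : Type*} [MetricSpace X] [MetricSpace Y]
    (fbar : X → Y) (f : Set (Set X) → Set (Set Y)) : Prop :=
  ∀ e : Set (Set X), IsEnd e → ∀ R ∈ e, fbar '' R ∈ f e

namespace IsRTree

variable {X : Type*} [MetricSpace X]

theorem exists_param (hT : IsRTree X) (a b : X) :
    ∃ γ : ℝ → X, (∀ u ∈ Set.Icc (0 : ℝ) (dist a b), ∀ v ∈ Set.Icc (0 : ℝ) (dist a b),
      dist (γ u) (γ v) = |u - v|) ∧ γ 0 = a ∧ γ (dist a b) = b := by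
  obtain ⟨s, ⟨γ, c, hc, hγ, h0, h1, -⟩, -⟩ := hT.1 a b
  have hd : dist a b = c := by
    rw [← h0, ← h1, hγ 0 ⟨le_rfl, hc⟩ c ⟨hc, le_rfl⟩, zero_sub, abs_neg, abs_of_nonneg hc]
  exact ⟨γ, by rwa [hd], h0, by rwa [hd]⟩

/-- There is a point at every prescribed distance along the segment from `a` to `b`. -/
theorem exists_point (hT : IsRTree X) (a b : X) {t : ℝ} (h0 : 0 ≤ t) (h1 : t ≤ dist a b) :
    ∃ m, dist a m = t ∧ dist m b = dist a b - t := by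
  obtain ⟨γ, hγ, ha, hb⟩ := hT.exists_param a b
  refine ⟨γ t, ?_, ?_⟩
  · nth_rewrite 1 [← ha]
    rw [hγ 0 ⟨le_rfl, dist_nonneg⟩ t ⟨h0, h1⟩, zero_sub, abs_neg, abs_of_nonneg h0]
  · nth_rewrite 1 [← hb]
    rw [hγ t ⟨h0, h1⟩ _ ⟨dist_nonneg, le_rfl⟩, abs_sub_comm, abs_of_nonneg (by linarith)]

end IsRTree

section Segment

variable {X : Type*} [MetricSpace X]

theorem IsGeodesicSegmentBetween.dist_add_dist {s : Set X} {a b m : X}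
    (hs : IsGeodesicSegmentBetween s a b) (hm : m ∈ s) :
    dist a m + dist m b = dist a b := by
  obtain ⟨γ, c, hc, hγ, rfl, rfl, rfl⟩ := hs
  obtain ⟨u, hu, rfl⟩ := hm
  rw [hγ 0 ⟨le_rfl, hc⟩ u hu, hγ u hu c ⟨hc, le_rfl⟩, hγ 0 ⟨le_rfl, hc⟩ c ⟨hc, le_rfl⟩,
    abs_sub_comm 0 u, abs_sub_comm u c, abs_sub_comm 0 c, abs_of_nonneg (by linarith [hu.1]),
    abs_of_nonneg (by linarith [hu.2]), abs_of_nonneg (by linarith)]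
  ring

theorem IsGeodesicSegmentBetween.eq_of_dist_eq {s : Set X} {a b m n : X}
    (hs : IsGeodesicSegmentBetween s a b) (hm : m ∈ s) (hn : n ∈ s)
    (h : dist a m = dist a n) : m = n := by
  obtain ⟨γ, c, hc, hγ, rfl, rfl, rfl⟩ := hs
  obtain ⟨u, hu, rfl⟩ := hm
  obtain ⟨v, hv, rfl⟩ := hn
  rw [hγ 0 ⟨le_rfl, hc⟩ u hu, hγ 0 ⟨le_rfl, hc⟩ v hv, zero_sub, zero_sub, abs_neg, abs_neg,
    abs_of_nonneg hu.1, abs_of_nonneg hv.1] at h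
  rw [h]

theorem IsGeodesicSegmentBetween.left_mem {s : Set X} {a b : X}
    (hs : IsGeodesicSegmentBetween s a b) : a ∈ s := by
  obtain ⟨γ, c, hc, hγ, rfl, rfl, rfl⟩ := hs
  exact ⟨0, ⟨le_rfl, hc⟩, rfl⟩

theorem IsGeodesicSegmentBetween.right_mem {s : Set X} {a b : X}
    (hs : IsGeodesicSegmentBetween s a b) : b ∈ s := by
  obtain ⟨γ, c, hc, hγ, rfl, rfl, rfl⟩ := hs
  exact ⟨c, ⟨hc, le_rfl⟩, rfl⟩

end Segment

namespace IsRTree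

variable {X : Type*} [MetricSpace X]

/-- A point between `a` and `b` lies on some geodesic segment from `a` to `b`. -/
theorem exists_segment_mem (hT : IsRTree X) {a b m : X}
    (hm : dist a m + dist m b = dist a b) :
    ∃ s, IsGeodesicSegmentBetween s a b ∧ m ∈ s := by
  obtain ⟨s, hs, -⟩ := hT.1 a m
  obtain ⟨t, ht, -⟩ := hT.1 m b
  refine ⟨s ∪ t, hT.2 s t a m b hs ht ?_, Or.inl hs.right_mem⟩
  ext z
  constructor
  · rintro ⟨hzs, hzt⟩
    have h1 := hs.dist_add_dist hzs
    have h2 := ht.dist_add_dist hzt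
    have h3 := dist_triangle a z b
    rw [dist_comm m z] at h2
    exact dist_le_zero.1 (by linarith)
  · rintro rfl
    exact ⟨hs.right_mem, ht.left_mem⟩

theorem eq_of_between (hT : IsRTree X) {a b m n : X} (hm : dist a m + dist m b = dist a b)
    (hn : dist a n + dist n b = dist a b) (h : dist a m = dist a n) : m = n := by
  obtain ⟨s, hs, hms⟩ := hT.exists_segment_mem hm
  obtain ⟨t, ht, hnt⟩ := hT.exists_segment_mem hn
  obtain rfl : s = t := (hT.1 a b).unique hs ht
  exact hs.eq_of_dist_eq hms hnt h

/-- Two points on the segment from `a` to `b` are ordered by their distance to `a`. -/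
theorem dist_eq_sub (hT : IsRTree X) {a b m n : X} (hm : dist a m + dist m b = dist a b)
    (hn : dist a n + dist n b = dist a b) (h : dist a m ≤ dist a n) :
    dist m n = dist a n - dist a m := by
  obtain ⟨k, hk1, hk2⟩ := hT.exists_point a n dist_nonneg h
  have h3 := dist_triangle k n b
  have h4 := dist_triangle a k b
  obtain rfl : k = m := hT.eq_of_between (a := a) (b := b) (by linarith) hm hk1
  exact hk2

/-- Any three points have a median. -/
theorem exists_median (hT : IsRTree X) (p x y : X) :
    ∃ m, dist p m + dist m x = dist p x ∧ dist p m + dist m y = dist p y ∧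
      dist x m + dist m y = dist x y := by
  obtain ⟨γ, hγ, hγ0, hγ1⟩ := hT.exists_param p x
  obtain ⟨σ, hσ, hσ0, hσ1⟩ := hT.exists_param p y
  set a := dist p x with ha
  set b := dist p y with hb
  have ha0 : 0 ≤ a := dist_nonneg
  have hb0 : 0 ≤ b := dist_nonneg
  set S : Set ℝ := {t | 0 ≤ t ∧ t ≤ a ∧ t ≤ b ∧ γ t = σ t} with hS
  have h0S : (0 : ℝ) ∈ S := ⟨le_rfl, ha0, hb0, by rw [hγ0, hσ0]⟩
  have hbdd : BddAbove S := ⟨a, fun t ht => ht.2.1⟩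
  set t₀ := sSup S with ht₀
  have h0 : 0 ≤ t₀ := le_csSup hbdd h0S
  have h1 : t₀ ≤ a := csSup_le ⟨0, h0S⟩ fun t ht => ht.2.1
  have h2 : t₀ ≤ b := csSup_le ⟨0, h0S⟩ fun t ht => ht.2.2.1
  have heq : γ t₀ = σ t₀ := by
    refine dist_le_zero.1 (le_of_forall_pos_le_add fun ε hε => ?_)
    obtain ⟨t, ht, htl⟩ := exists_lt_of_lt_csSup ⟨0, h0S⟩ (show t₀ - ε / 2 < sSup S by linarith)
    have h4 : t ≤ t₀ := le_csSup hbdd ht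
    have h5 := hγ t₀ ⟨h0, h1⟩ t ⟨ht.1, ht.2.1⟩
    have h6 := hσ t ⟨ht.1, ht.2.2.1⟩ t₀ ⟨h0, h2⟩
    rw [abs_of_nonneg (by linarith)] at h5
    rw [abs_sub_comm, abs_of_nonneg (by linarith)] at h6
    have h7 := dist_triangle (γ t₀) (γ t) (σ t₀)
    rw [ht.2.2.2] at h7 h5
    linarith
  have dγ : ∀ u, 0 ≤ u → u ≤ a → dist p (γ u) = u := fun u hu hu' => by
    rw [← hγ0, hγ 0 ⟨le_rfl, ha0⟩ u ⟨hu, hu'⟩, zero_sub, abs_neg, abs_of_nonneg hu]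
  have dσ : ∀ u, 0 ≤ u → u ≤ b → dist p (σ u) = u := fun u hu hu' => by
    rw [← hσ0, hσ 0 ⟨le_rfl, hb0⟩ u ⟨hu, hu'⟩, zero_sub, abs_neg, abs_of_nonneg hu]
  have s1 : IsGeodesicSegmentBetween (γ '' Set.Icc t₀ a) x (γ t₀) := by
    refine ⟨fun u => γ (a - u), a - t₀, by linarith, ?_, by simpa using hγ1, by simp, ?_⟩
    · intro u hu v hv
      rw [hγ _ ⟨by linarith [hu.2], by linarith [hu.1]⟩ _ ⟨by linarith [hv.2], by linarith [hv.1]⟩,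
        abs_sub_comm]
      congr 1
      ring
    · ext z
      constructor
      · rintro ⟨u, hu, rfl⟩
        exact ⟨a - u, ⟨by linarith [hu.2], by linarith [hu.1]⟩, by simp⟩
      · rintro ⟨u, hu, rfl⟩
        exact ⟨a - u, ⟨by linarith [hu.2], by linarith [hu.1]⟩, rfl⟩
  have s2 : IsGeodesicSegmentBetween (σ '' Set.Icc t₀ b) (γ t₀) y := by
    refine ⟨fun u => σ (t₀ + u), b - t₀, by linarith, ?_, by simpa using heq.symm,
      by simpa using hσ1, ?_⟩
    · intro u hu v hv
      rw [hσ _ ⟨by linarith [hu.1], by linarith [hu.2]⟩ _ ⟨by linarith [hv.1], by linarith [hv.2]⟩]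
      congr 1
      ring
    · ext z
      constructor
      · rintro ⟨u, hu, rfl⟩
        exact ⟨u - t₀, ⟨by linarith [hu.1], by linarith [hu.2]⟩, by simp⟩
      · rintro ⟨u, hu, rfl⟩
        exact ⟨t₀ + u, ⟨by linarith [hu.1], by linarith [hu.2]⟩, rfl⟩
  have s3 := hT.2 _ _ _ _ _ s1 s2 <| by
    ext z
    constructor
    · rintro ⟨⟨u, hu, rfl⟩, ⟨v, hv, hvu⟩⟩
      have e1 := dγ u (h0.trans hu.1) hu.2
      have e2 := dσ v (h0.trans hv.1) hv.2
      rw [hvu, e1] at e2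
      subst e2
      have : u ≤ t₀ := le_csSup hbdd ⟨h0.trans hu.1, hu.2, hv.2, hvu.symm⟩
      rw [le_antisymm this hu.1]
      rfl
    · rintro rfl
      exact ⟨s1.right_mem, s2.left_mem⟩
  refine ⟨γ t₀, ?_, ?_, s3.dist_add_dist (Or.inl s1.right_mem)⟩
  · rw [dγ t₀ h0 h1]
    nth_rewrite 1 [← hγ1]
    rw [hγ t₀ ⟨h0, h1⟩ a ⟨ha0, le_rfl⟩, abs_sub_comm, abs_of_nonneg (by linarith)]
    ring
  · rw [heq, dσ t₀ h0 h2]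
    nth_rewrite 1 [← hσ1]
    rw [hσ t₀ ⟨h0, h2⟩ b ⟨hb0, le_rfl⟩, abs_sub_comm, abs_of_nonneg (by linarith)]
    ring

/-- The four-point condition. -/
theorem four_point (hT : IsRTree X) (p x y z : X) :
    dist x y + dist p z ≤ max (dist p x + dist z y) (dist p y + dist x z) := by
  obtain ⟨m, m1, m2, m3⟩ := hT.exists_median p x z
  obtain ⟨n, n1, n2, n3⟩ := hT.exists_median p y z
  have t1 := dist_triangle x m y
  have t2 := dist_triangle x n y
  have c1 := dist_comm m x
  have c2 := dist_comm n y
  have c3 := dist_comm z y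
  have c4 := dist_comm n x
  have c5 := dist_comm m n
  rcases le_total (dist p m) (dist p n) with h | h
  · have := hT.dist_eq_sub m2 n2 h
    have := dist_triangle m n y
    refine le_max_of_le_right ?_
    linarith
  · have := hT.dist_eq_sub n2 m2 h
    have := dist_triangle n m x
    refine le_max_of_le_left ?_
    linarith

/-- The fixed point set of an isometry is convex. -/
theorem fixed_of_between (hT : IsRTree X) (h : X ≃ᵢ X) {a b k : X} (ha : h a = a) (hb : h b = b)
    (hk : dist a k + dist k b = dist a b) : h k = k := by
  have h1 : dist a (h k) = dist a k := by
    nth_rewrite 1 [← ha]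
    exact h.dist_eq a k
  have h2 : dist (h k) b = dist k b := by
    nth_rewrite 1 [← hb]
    exact h.dist_eq k b
  exact hT.eq_of_between (by rw [h1, h2, hk]) hk h1

/-- The projection of a point to the fixed point set of an elliptic isometry. -/
theorem exists_proj (hT : IsRTree X) (h : X ≃ᵢ X) (hq : ∃ q, h q = q) (x : X) :
    ∃ p, h p = p ∧ 2 * dist x p = dist x (h x) ∧
      ∀ q, h q = q → dist x p + dist p q = dist x q := by
  have key : ∀ q, h q = q → ∃ p, h p = p ∧ 2 * dist x p = dist x (h x) ∧
      dist x p + dist p (h x) = dist x (h x) ∧ dist x p + dist p q = dist x q := by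
    intro q hq
    obtain ⟨p, p1, p2, p3⟩ := hT.exists_median q x (h x)
    have e1 : dist q (h x) = dist q x := by
      nth_rewrite 1 [← hq]
      exact h.dist_eq q x
    have e2 : dist q (h p) = dist q p := by
      nth_rewrite 1 [← hq]
      exact h.dist_eq q p
    have e3 := h.dist_eq p x
    have c1 := dist_comm x p
    have c2 := dist_comm p q
    have c3 := dist_comm x q
    refine ⟨p, ?_, by linarith, by linarith, by linarith⟩
    exact hT.eq_of_between (a := q) (b := h x) (by linarith) p2 e2
  obtain ⟨q, hq⟩ := hq
  obtain ⟨p, p1, p2, p3, p4⟩ := key q hq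
  refine ⟨p, p1, p2, fun q' hq' => ?_⟩
  obtain ⟨p', p1', p2', p3', p4'⟩ := key q' hq'
  obtain rfl : p = p' := hT.eq_of_between p3 p3' (by linarith)
  exact p4'

/-- If `g`, `h` and `g ∘ h` are elliptic, then `g` and `h` have a common fixed point. -/
theorem exists_common_fixed (hT : IsRTree X) (g h : X ≃ᵢ X) (hg : ∃ q, g q = q)
    (hh : ∃ q, h q = q) (hgh : ∃ q, g (h q) = q) : ∃ q, g q = q ∧ h q = q := by
  obtain ⟨x, hx⟩ := hh
  obtain ⟨a, ga, -, a3⟩ := hT.exists_proj g hg x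
  obtain ⟨b, hb, b2, b3⟩ := hT.exists_proj h ⟨x, hx⟩ a
  obtain ⟨c, gc, c2, c3⟩ := hT.exists_proj g hg b
  obtain ⟨q, hq⟩ := hgh
  have hca : c = a := by
    have h1 := c3 a ga
    have h2 := a3 c gc
    have h3 := b3 x hx
    have h4 := dist_triangle x b c
    have e1 := dist_comm a x
    have e2 := dist_comm a b
    have e3 := dist_comm b x
    have e4 := dist_comm c a
    exact dist_le_zero.1 (by linarith [dist_nonneg (x := a) (y := c)])
  subst hca
  have e1 : dist b (h q) = dist b q := by
    nth_rewrite 1 [← hb]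
    exact h.dist_eq b q
  have e2 : dist c (h q) = dist c q := by
    rw [← g.dist_eq c (h q), gc, hq]
  have e3 : dist b (h c) = dist b c := by
    nth_rewrite 1 [← hb]
    exact h.dist_eq b c
  have e4 : dist c (g b) = dist c b := by
    nth_rewrite 1 [← gc]
    exact g.dist_eq c b
  have e5 : dist (h q) (h c) = dist q c := h.dist_eq q c
  have e6 : dist q (g b) = dist (h q) b := by
    nth_rewrite 1 [← hq]
    exact g.dist_eq (h q) b
  have f1 := hT.four_point b c (h c) (h q)
  have f2 := hT.four_point c b (g b) q
  have k1 := dist_comm b c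
  have k2 := dist_comm q c
  have k3 := dist_comm q b
  have k4 := dist_comm (h q) b
  rw [show dist b c + dist (h q) (h c) = dist b c + dist c q by linarith,
    show dist b (h c) + dist c (h q) = dist b c + dist c q by linarith, max_self] at f1
  rw [show dist c b + dist q (g b) = dist b c + dist b q by linarith,
    show dist c (g b) + dist b q = dist b c + dist b q by linarith, max_self] at f2
  have : b = c := dist_le_zero.1 (by linarith)
  exact ⟨c, gc, this ▸ hb⟩

end IsRTree

section Rays

/-- The rays parametrized by `α` and `β` agree eventually, up to a shift of the parameter. -/
def EventuallyAgree {X : Type*} (α β : ℝ → X) : Prop :=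
  ∃ a b : ℝ, 0 ≤ a ∧ 0 ≤ b ∧ ∀ t, 0 ≤ t → α (a + t) = β (b + t)

theorem EventuallyAgree.symm {X : Type*} {α β : ℝ → X} (h : EventuallyAgree α β) : EventuallyAgree β α := by
  obtain ⟨a, b, ha, hb, h⟩ := h
  exact ⟨b, a, hb, ha, fun t ht => (h t ht).symm⟩

theorem EventuallyAgree.trans {X : Type*} {α β γ : ℝ → X} (h : EventuallyAgree α β)
    (h' : EventuallyAgree β γ) : EventuallyAgree α γ := by
  obtain ⟨a, b, ha, hb, h⟩ := h
  obtain ⟨c, d, hc, hd, h'⟩ := h'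
  refine ⟨a + c, d + b, by linarith, by linarith, fun t ht => ?_⟩
  rw [add_assoc, h _ (by linarith), add_assoc, ← h' _ (by linarith)]
  congr 1
  ring

variable {X : Type*} [MetricSpace X]

/-- `α` parametrizes a ray by arc length. -/
def IsRayParam (α : ℝ → X) : Prop :=
  ∀ u ∈ Set.Ici (0 : ℝ), ∀ v ∈ Set.Ici (0 : ℝ), dist (α u) (α v) = |u - v|

/-- An isometric self-map of a half-line is a translation. -/
theorem eq_add_of_abs_sub_eq {f : ℝ → ℝ} (hf0 : ∀ t, 0 ≤ t → 0 ≤ f t)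
    (hf : ∀ u, 0 ≤ u → ∀ v, 0 ≤ v → |f u - f v| = |u - v|) {t : ℝ} (ht : 0 ≤ t) :
    f t = f 0 + t := by
  have hT : 0 ≤ t + f 0 + 1 := by linarith [hf0 0 le_rfl]
  have h0 := hf0 0 le_rfl
  have h1 := hf0 t ht
  have h2 := hf0 _ hT
  have e1 := hf t ht 0 le_rfl
  have e2 := hf _ hT 0 le_rfl
  have e3 := hf _ hT t ht
  rw [abs_of_nonneg (a := t - 0) (by linarith)] at e1
  rw [abs_of_nonneg (a := _ - (0 : ℝ)) (by linarith)] at e2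
  rw [abs_of_nonneg (a := t + f 0 + 1 - t) (by linarith)] at e3
  rcases abs_cases (f t - f 0) with ⟨a1, _⟩ | ⟨a1, _⟩ <;>
  rcases abs_cases (f (t + f 0 + 1) - f 0) with ⟨a2, _⟩ | ⟨a2, _⟩ <;>
  rcases abs_cases (f (t + f 0 + 1) - f t) with ⟨a3, _⟩ | ⟨a3, _⟩ <;> linarith

theorem IsRayParam.dist_eq {α : ℝ → X} (hα : IsRayParam α) {u v : ℝ} (hu : 0 ≤ u) (huv : u ≤ v) :
    dist (α u) (α v) = v - u := by
  rw [hα u hu v (hu.trans huv), abs_sub_comm, abs_of_nonneg (by linarith)]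

theorem IsRayParam.isRay {α : ℝ → X} (hα : IsRayParam α) : IsRay (α '' Set.Ici 0) :=
  ⟨α, hα, rfl⟩

theorem IsRayParam.comp {α : ℝ → X} (hα : IsRayParam α) (h : X ≃ᵢ X) :
    IsRayParam (fun t => h (α t)) := fun u hu v hv => by
  rw [h.dist_eq, hα u hu v hv]

theorem IsRayParam.shift {α : ℝ → X} (hα : IsRayParam α) {a : ℝ} (ha : 0 ≤ a) :
    IsRayParam (fun t => α (a + t)) := fun u hu v hv => by
  rw [hα _ (add_nonneg ha hu) _ (add_nonneg ha hv)]
  congr 1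
  ring

/-- A ray contained in the image of another ray is a reparametrized tail of it. -/
theorem IsRayParam.exists_shift {α ρ : ℝ → X} (hα : IsRayParam α) (hρ : IsRayParam ρ)
    (hsub : ∀ t, 0 ≤ t → ρ t ∈ α '' Set.Ici 0) :
    ∃ a, 0 ≤ a ∧ ∀ t, 0 ≤ t → ρ t = α (a + t) := by
  have : ∀ t, ∃ s, 0 ≤ t → 0 ≤ s ∧ α s = ρ t := fun t => by
    by_cases ht : 0 ≤ t
    · obtain ⟨s, hs, h⟩ := hsub t ht
      exact ⟨s, fun _ => ⟨hs, h⟩⟩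
    · exact ⟨0, fun h => absurd h ht⟩
  choose f hf using this
  refine ⟨f 0, (hf 0 le_rfl).1, fun t ht => ?_⟩
  rw [← eq_add_of_abs_sub_eq (fun t ht => (hf t ht).1) (fun u hu v hv => ?_) ht, (hf t ht).2]
  rw [← hα _ (hf u hu).1 _ (hf v hv).1, (hf u hu).2, (hf v hv).2, hρ u hu v hv]

theorem EventuallyAgree.of_isRay_inter {α β : ℝ → X} (hα : IsRayParam α) (hβ : IsRayParam β)
    (h : IsRay (α '' Set.Ici 0 ∩ β '' Set.Ici 0)) : EventuallyAgree α β := by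
  obtain ⟨ρ, hρ, he⟩ := h
  have hmem : ∀ t, 0 ≤ t → ρ t ∈ α '' Set.Ici 0 ∩ β '' Set.Ici 0 := fun t ht => by
    rw [he]
    exact ⟨t, ht, rfl⟩
  obtain ⟨a, ha, h1⟩ := hα.exists_shift hρ fun t ht => (hmem t ht).1
  obtain ⟨b, hb, h2⟩ := hβ.exists_shift hρ fun t ht => (hmem t ht).2
  exact ⟨a, b, ha, hb, fun t ht => by rw [← h1 t ht, h2 t ht]⟩

theorem EventuallyAgree.isRay_inter (hT : IsRTree X) {α β : ℝ → X} (hα : IsRayParam α)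
    (hβ : IsRayParam β) (h : EventuallyAgree α β) :
    IsRay (α '' Set.Ici 0 ∩ β '' Set.Ici 0) := by
  obtain ⟨a, b, ha, hb, h⟩ := h
  set S : Set ℝ := {u | 0 ≤ u ∧ 0 ≤ u - a + b ∧ α u = β (u - a + b)} with hS
  have haS : a ∈ S := ⟨ha, by linarith, by simpa using h 0 le_rfl⟩
  have hbdd : BddBelow S := ⟨0, fun t ht => ht.1⟩
  have upper : ∀ u ∈ S, ∀ v, u ≤ v → v ∈ S := by
    rintro u ⟨hu0, hu1, hu⟩ v huv
    refine ⟨by linarith, by linarith, ?_⟩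
    set w := max v a with hw
    have hwa : a ≤ w := le_max_right _ _
    have hwv : v ≤ w := le_max_left _ _
    have e1 := h (w - a) (by linarith)
    rw [show a + (w - a) = w by ring] at e1
    have d1 := hα.dist_eq hu0 huv
    have d2 := hα.dist_eq (hu0.trans huv) hwv
    have d3 := hα.dist_eq hu0 (huv.trans hwv)
    have d4 := hβ.dist_eq hu1 (show u - a + b ≤ v - a + b by linarith)
    have d5 := hβ.dist_eq (show 0 ≤ v - a + b by linarith)
      (show v - a + b ≤ b + (w - a) by linarith)
    rw [← e1] at d5
    rw [← hu] at d4
    exact hT.eq_of_between (a := α u) (b := α w) (by linarith) (by linarith) (by linarith)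
  set u₀ := sInf S with hu₀
  have h0 : 0 ≤ u₀ := le_csInf ⟨a, haS⟩ fun t ht => ht.1
  have h1 : 0 ≤ u₀ - a + b := by
    have : a - b ≤ u₀ := le_csInf ⟨a, haS⟩ fun t ht => by linarith [ht.2.1]
    linarith
  have hmem : u₀ ∈ S := by
    refine ⟨h0, h1, dist_le_zero.1 (le_of_forall_pos_le_add fun ε hε => ?_)⟩
    obtain ⟨t, ht, htl⟩ := exists_lt_of_csInf_lt ⟨a, haS⟩ (show sInf S < u₀ + ε / 2 by linarith)
    have h4 : u₀ ≤ t := csInf_le hbdd ht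
    have h5 := hα.dist_eq h0 h4
    have h6 := hβ.dist_eq h1 (show u₀ - a + b ≤ t - a + b by linarith)
    rw [← ht.2.2, dist_comm] at h6
    have h7 := dist_triangle (α u₀) (α t) (β (u₀ - a + b))
    linarith
  refine ⟨fun t => α (u₀ + t), hα.shift h0, ?_⟩
  ext z
  constructor
  · rintro ⟨⟨u, hu, rfl⟩, ⟨v, hv, hvu⟩⟩
    have hu' : (0 : ℝ) ≤ u := hu
    have hv' : (0 : ℝ) ≤ v := hv
    have huS : u ∈ S := by
      have e1 := h (u + v) (by linarith)
      have d1 := hα.dist_eq hu' (show u ≤ a + (u + v) by linarith)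
      have d2 := hβ.dist_eq hv' (show v ≤ b + (u + v) by linarith)
      rw [hvu, ← e1] at d2
      have : v = u - a + b := by linarith
      exact ⟨hu', by linarith, by rw [← this, hvu]⟩
    exact ⟨u - u₀, by simpa using csInf_le hbdd huS, by simp⟩
  · rintro ⟨t, ht, rfl⟩
    have ht' : (0 : ℝ) ≤ t := ht
    obtain ⟨k1, k2, k3⟩ := upper u₀ hmem (u₀ + t) (by linarith)
    exact ⟨⟨_, k1, rfl⟩, ⟨_, k2, k3.symm⟩⟩

/-- The set of rays equivalent to the ray parametrized by `α`. -/
def endOf (α : ℝ → X) : Set (Set X) :=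
  {R' : Set X | IsRay R' ∧ IsRay (R' ∩ α '' Set.Ici 0)}

theorem mem_endOf_iff (hT : IsRTree X) {α : ℝ → X} (hα : IsRayParam α) {R : Set X} :
    R ∈ endOf α ↔ ∃ β, IsRayParam β ∧ R = β '' Set.Ici 0 ∧ EventuallyAgree β α := by
  constructor
  · rintro ⟨⟨β, hβ, rfl⟩, h⟩
    exact ⟨β, hβ, rfl, .of_isRay_inter hβ hα h⟩
  · rintro ⟨β, hβ, rfl, h⟩
    exact ⟨hβ.isRay, h.isRay_inter hT hβ hα⟩

theorem endOf_eq (hT : IsRTree X) {α β : ℝ → X} (hα : IsRayParam α) (hβ : IsRayParam β)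
    (h : EventuallyAgree α β) : endOf α = endOf β := by
  ext R
  rw [mem_endOf_iff hT hα, mem_endOf_iff hT hβ]
  exact ⟨fun ⟨γ, h1, h2, h3⟩ => ⟨γ, h1, h2, h3.trans h⟩,
    fun ⟨γ, h1, h2, h3⟩ => ⟨γ, h1, h2, h3.trans h.symm⟩⟩

theorem image_mem_endOf (hT : IsRTree X) {α : ℝ → X} (hα : IsRayParam α) (h : X ≃ᵢ X)
    (hag : EventuallyAgree (fun t => h (α t)) α) {R : Set X} (hR : R ∈ endOf α) :
    h '' R ∈ endOf α := by
  obtain ⟨β, hβ, rfl, a, b, ha, hb, hab⟩ := (mem_endOf_iff hT hα).1 hR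
  refine (mem_endOf_iff hT hα).2 ⟨fun t => h (β t), hβ.comp h, by rw [Set.image_image], ?_⟩
  exact EventuallyAgree.trans ⟨a, b, ha, hb, fun t ht => congrArg h (hab t ht)⟩ hag

/-- An elliptic isometry fixing the end of a ray fixes a tail of this ray pointwise. -/
theorem IsRayParam.fixed_of_eventuallyAgree {α : ℝ → X} (hα : IsRayParam α) (h : X ≃ᵢ X)
    (hq : ∃ q, h q = q) (hag : EventuallyAgree (fun t => h (α t)) α) :
    ∃ a, 0 ≤ a ∧ ∀ s, a ≤ s → h (α s) = α s := by
  obtain ⟨q, hq⟩ := hq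
  obtain ⟨a, b, ha, hb, hab⟩ := hag
  have hdist : ∀ t, 0 ≤ t → dist q (α (a + t)) = dist q (α (b + t)) := fun t ht => by
    rw [← h.dist_eq q, hq]
    exact congrArg (dist q) (hab t ht)
  have hunb : ∀ t, 0 ≤ t → t ≤ dist q (α 0) + dist q (α t) := fun t ht => by
    have h1 := hα.dist_eq le_rfl ht
    have h2 := dist_triangle_left (α 0) (α t) q
    linarith
  have aux : ∀ c d : ℝ, 0 ≤ c → c < d →
      (∀ t, 0 ≤ t → dist q (α (c + t)) = dist q (α (d + t))) → False := by
    intro c d hc hcd hper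
    have hn : ∀ n : ℕ, dist q (α (c + n * (d - c))) = dist q (α c) := by
      intro n
      induction n with
      | zero => simp
      | succ n ih =>
        rw [← ih, hper _ (mul_nonneg n.cast_nonneg (by linarith))]
        congr 2
        push_cast
        ring
    obtain ⟨n, hn'⟩ := exists_nat_gt ((dist q (α 0) + dist q (α c)) / (d - c))
    rw [div_lt_iff₀ (by linarith)] at hn'
    have h1 := hunb (c + n * (d - c))
      (add_nonneg hc (mul_nonneg n.cast_nonneg (by linarith)))
    rw [hn n] at h1
    linarith
  have hab' : a = b := by
    rcases lt_trichotomy a b with hlt | heq | hlt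
    · exact (aux a b ha hlt hdist).elim
    · exact heq
    · exact (aux b a hb hlt fun t ht => (hdist t ht).symm).elim
  subst hab'
  refine ⟨a, ha, fun s hs => ?_⟩
  simpa using hab (s - a) (by linarith)

/-- A ray `γ` whose points all lie between `γ 0` and far away points of `α` has the same end as
`α`. -/
theorem EventuallyAgree.of_between (hT : IsRTree X) {α γ : ℝ → X} (hα : IsRayParam α)
    (hγ : IsRayParam γ)
    (hbt : ∀ t, 0 ≤ t → ∃ s, 0 ≤ s ∧
      dist (γ 0) (γ t) + dist (γ t) (α s) = dist (γ 0) (α s)) :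
    EventuallyAgree γ α := by
  have hk : 0 ≤ dist (γ 0) (α 0) := dist_nonneg
  obtain ⟨a, ha, h⟩ := hα.exists_shift (hγ.shift hk) fun t ht => by
    obtain ⟨s, hs, hbs⟩ := hbt (dist (γ 0) (α 0) + t) (by linarith)
    obtain ⟨m, m1, m2, m3⟩ := hT.exists_median (γ 0) (α 0) (α s)
    set z := γ (dist (γ 0) (α 0) + t) with hz
    have hd := hγ.dist_eq le_rfl (show 0 ≤ dist (γ 0) (α 0) + t by linarith)
    rw [← hz] at hd
    have hd2 := hT.dist_eq_sub m2 hbs (by linarith [dist_nonneg (x := m) (y := α 0)])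
    have t1 := dist_triangle (α 0) m z
    have t2 := dist_triangle (α 0) z (α s)
    have hs' := hα.dist_eq le_rfl hs
    have hle : dist (α 0) z ≤ s := by linarith [dist_nonneg (x := z) (y := α s)]
    refine ⟨dist (α 0) z, dist_nonneg, ?_⟩
    have d1 := hα.dist_eq le_rfl (dist_nonneg (x := α 0) (y := z))
    have d2 := hα.dist_eq (dist_nonneg (x := α 0) (y := z)) hle
    exact hT.eq_of_between (a := α 0) (b := α s) (by linarith) (by linarith) (by linarith)
  exact ⟨_, a, hk, ha, h⟩

end Rays

/-- A group of elliptic isometries with an unbounded orbit through `x` admits a ray from `x` of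
which every element fixes a tail, and whose points separate `x` from fixed points of suitable
elements. -/
theorem IsRTree.exists_ray {X : Type*} [MetricSpace X] (hT : IsRTree X)
    (H : Subgroup (X ≃ᵢ X)) (hell : ∀ h ∈ H, ∃ x : X, h x = x) (x : X)
    (hunb : ¬ ∃ C : ℝ, ∀ h ∈ H, dist x (h x) ≤ C) :
    ∃ γ : ℝ → X, IsRayParam γ ∧ γ 0 = x ∧
      (∀ h ∈ H, ∃ a, 0 ≤ a ∧ ∀ s, a ≤ s → h (γ s) = γ s) ∧
      ∀ t, 0 ≤ t → ∃ h ∈ H, ∀ q, h q = q → dist x (γ t) + dist (γ t) q = dist x q := by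
  have hproj : ∀ h : H, ∃ p, h.1 p = p ∧ 2 * dist x p = dist x (h.1 x) ∧
      ∀ q, h.1 q = q → dist x p + dist p q = dist x q :=
    fun h => hT.exists_proj h.1 (hell h.1 h.2) x
  choose p pfix pdist pbtw using hproj
  have order : ∀ g h : H, dist x (p g) ≤ dist x (p h) →
      g.1 (p h) = p h ∧ dist x (p g) + dist (p g) (p h) = dist x (p h) := by
    intro g h hle
    obtain ⟨q, gq, hq⟩ := hT.exists_common_fixed g.1 h.1 (hell _ g.2) (hell _ h.2)
      (hell _ (H.mul_mem g.2 h.2))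
    have b1 := pbtw g q gq
    have b2 := pbtw h q hq
    have d := hT.dist_eq_sub b1 b2 hle
    exact ⟨hT.fixed_of_between g.1 (pfix g) gq (by linarith), by linarith⟩
  have far : ∀ t : ℝ, ∃ h : H, t ≤ dist x (p h) := by
    intro t
    by_contra! hcon
    refine hunb ⟨2 * t, fun h hh => ?_⟩
    have h1 := hcon ⟨h, hh⟩
    have h2 := pdist ⟨h, hh⟩
    simp only at h2
    linarith
  choose k hk using far
  have hpt : ∀ t : ℝ, ∃ z, 0 ≤ t → dist x z = t ∧ dist z (p (k t)) = dist x (p (k t)) - t := by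
    intro t
    by_cases ht : 0 ≤ t
    · obtain ⟨z, hz⟩ := hT.exists_point x (p (k t)) ht (hk t)
      exact ⟨z, fun _ => hz⟩
    · exact ⟨x, fun h => absurd h ht⟩
  choose γ hγ using hpt
  have btw : ∀ t, 0 ≤ t → ∀ h, dist x (p (k t)) ≤ dist x (p h) →
      dist x (γ t) + dist (γ t) (p h) = dist x (p h) := by
    intro t ht h hle
    have h1 := (order _ _ hle).2
    obtain ⟨h2, h3⟩ := hγ t ht
    have h4 := dist_triangle (γ t) (p (k t)) (p h)
    have h5 := dist_triangle x (γ t) (p h)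
    linarith
  have mono : ∀ u v, 0 ≤ u → u ≤ v → dist (γ u) (γ v) = v - u := by
    intro u v hu huv
    have hv := hu.trans huv
    have hd : dist x (γ u) ≤ dist x (γ v) := by rw [(hγ u hu).1, (hγ v hv).1]; exact huv
    rcases le_total (dist x (p (k u))) (dist x (p (k v))) with hle | hle
    · rw [hT.dist_eq_sub (btw u hu _ hle) (btw v hv _ le_rfl) hd, (hγ u hu).1, (hγ v hv).1]
    · rw [hT.dist_eq_sub (btw u hu _ le_rfl) (btw v hv _ hle) hd, (hγ u hu).1, (hγ v hv).1]
  refine ⟨γ, ?_, (dist_eq_zero.1 (hγ 0 le_rfl).1).symm, ?_, ?_⟩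
  · intro u hu v hv
    rcases le_total u v with huv | huv
    · rw [mono u v hu huv, abs_sub_comm, abs_of_nonneg (by linarith)]
    · rw [dist_comm, mono v u hv huv, abs_of_nonneg (by linarith)]
  · intro h hh
    refine ⟨dist x (p ⟨h, hh⟩), dist_nonneg, fun s hs => ?_⟩
    have hs0 : 0 ≤ s := dist_nonneg.trans hs
    obtain ⟨o1, o2⟩ := order ⟨h, hh⟩ (k s) (hs.trans (hk s))
    have b := btw s hs0 (k s) le_rfl
    have d := hT.dist_eq_sub o2 b (by rw [(hγ s hs0).1]; exact hs)
    refine hT.fixed_of_between h (pfix ⟨h, hh⟩) o1 ?_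
    linarith
  · intro t ht
    refine ⟨(k t).1, (k t).2, fun q hq => ?_⟩
    have h1 := pbtw (k t) q hq
    obtain ⟨h2, h3⟩ := hγ t ht
    have h4 := dist_triangle (γ t) (p (k t)) q
    have h5 := dist_triangle x (γ t) q
    linarith

theorem elliptic_group_bounded_or_unique_fixed_end {X : Type*} [MetricSpace X]
    (htree : IsRTree X) (hleaf : Leafless X)
    (H : Subgroup (X ≃ᵢ X)) (hell : ∀ h ∈ H, ∃ x : X, h x = x) :
    (∀ x : X, ∃ C : ℝ, ∀ h ∈ H, ∀ h' ∈ H, dist (h x) (h' x) ≤ C) ∨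
    ((∃! e : Set (Set X), IsEnd e ∧ ∀ h ∈ H, pushEnd (⇑h) e = e) ∧
      ∀ x : X, ¬ ∃ C : ℝ, ∀ h ∈ H, ∀ h' ∈ H, dist (h x) (h' x) ≤ C) := by
  refine or_iff_not_imp_left.2 fun hnb => ?_
  push Not at hnb
  obtain ⟨x, hx⟩ := hnb
  have hunb : ∀ y : X, ¬ ∃ C : ℝ, ∀ h ∈ H, ∀ h' ∈ H, dist (h y) (h' y) ≤ C := by
    rintro y ⟨C, hC⟩
    obtain ⟨h, hh, h', hh', hlt⟩ := hx (C + 2 * dist x y)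
    have h1 := dist_triangle4 (h x) (h y) (h' y) (h' x)
    rw [h.dist_eq, h'.dist_eq, dist_comm y x] at h1
    linarith [hC h hh h' hh']
  have hunb' : ¬ ∃ C : ℝ, ∀ h ∈ H, dist x (h x) ≤ C := by
    rintro ⟨C, hC⟩
    obtain ⟨h, hh, h', hh', hlt⟩ := hx (2 * C)
    have h1 := dist_triangle_left (h x) (h' x) x
    linarith [hC h hh, hC h' hh']
  obtain ⟨γ, hγ, hγ0, hfix, hsep⟩ := htree.exists_ray H hell x hunb'
  have hag : ∀ h ∈ H, EventuallyAgree (fun t => h (γ t)) γ := fun h hh => by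
    obtain ⟨a, ha, hs⟩ := hfix h hh
    exact ⟨a, a, ha, ha, fun t ht => hs _ (by linarith)⟩
  refine ⟨⟨endOf γ, ⟨⟨_, hγ.isRay, rfl⟩, fun h hh => ?_⟩, ?_⟩, hunb⟩
  · refine Set.Subset.antisymm ?_ fun R hR => ?_
    · rintro _ ⟨R, hR, rfl⟩
      exact image_mem_endOf htree hγ h (hag h hh) hR
    · refine ⟨(h⁻¹ : X ≃ᵢ X) '' R,
        image_mem_endOf htree hγ h⁻¹ (hag h⁻¹ (H.inv_mem hh)) hR, ?_⟩
      rw [Set.image_image]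
      simp
  · rintro e ⟨⟨R, ⟨α, hα, rfl⟩, rfl⟩, he⟩
    change IsRayParam α at hα
    change endOf α = endOf γ
    refine (endOf_eq htree hγ hα (.of_between htree hα hγ fun t ht => ?_)).symm
    obtain ⟨h, hh, hq⟩ := hsep t ht
    have hmem : h '' (α '' Set.Ici 0) ∈ endOf α := by
      have := he h hh
      change pushEnd h (endOf α) = endOf α at this
      rw [← this]
      exact ⟨_, ⟨hα.isRay, by rw [Set.inter_self]; exact hα.isRay⟩, rfl⟩
    have hagα : EventuallyAgree (fun t => h (α t)) α := by
      rw [Set.image_image] at hmem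
      exact .of_isRay_inter (hα.comp h) hα hmem.2
    obtain ⟨a, ha, has⟩ := hα.fixed_of_eventuallyAgree h (hell h hh) hagα
    exact ⟨a, ha, hγ0 ▸ hq _ (has a le_rfl)⟩
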